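/- Let A be a 6×6 additive-multiplicative magic square of distinct positive integers whose magic product P has the form P = p^s·q^5 for distinct primes p and q and a positive integer s, or the form P = p^s·q^2·r for pairwise distinct primes p, q, r and a positive integer s. Then p = 2, p = 3, or p = 5. -/

import Mathlib

/-- `A` is an `n × n` additive-multiplicative magic square of pairwise distinct
positive integers, with magic sum `S` and magic product `P`: every row, every
column, and both long diagonals have sum `S` and product `P`. -/
def IsAddMulMagicSquare (n : ℕ) (A : Fin n → Fin n → ℕ) (S P : ℕ) : Prop :=
  (∀ i j, 0 < A i j) ∧
  (Function.Injective fun c : Fin n × Fin n => A c.1 c.2) ∧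
  (∀ i, ∑ j, A i j = S) ∧
  (∀ j, ∑ i, A i j = S) ∧
  (∑ i, A i i = S) ∧
  (∑ i, A i i.rev = S) ∧
  (∀ i, ∏ j, A i j = P) ∧
  (∀ j, ∏ i, A i j = P) ∧
  (∏ i, A i i = P) ∧
  (∏ i, A i i.rev = P)

theorem magic_key (A : Fin 6 → Fin 6 → ℕ) (S P : ℕ)
    (hA : IsAddMulMagicSquare 6 A S P) (p : ℕ) (hp : p.Prime) (hp7 : 7 ≤ p)
    (m s : ℕ) (hpm : ¬ p ∣ m) (hcard : m.divisors.card ≤ 6) (hP : P = p ^ s * m) : False := by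
  obtain ⟨hpos, hinj, hrow, hcol, -, -, hrowP, hcolP, -, -⟩ := hA
  have hm0 : 0 < m := by
    rcases Nat.eq_zero_or_pos m with h | h
    · subst h; simp at hpm
    · exact h
  -- every row has a large entry
  have hlarge : ∀ i, ∃ j, S ≤ 6 * A i j := by
    intro i
    by_contra! h
    have h1 := hrow i
    rw [Fin.sum_univ_six] at h1
    have := h 0; have := h 1; have := h 2; have := h 3; have := h 4; have := h 5
    omega
  have hlt : ∀ i j, A i j < S := by
    intro i j
    have h1 := hrow i
    rw [Fin.sum_univ_six] at h1
    have := hpos i 0; have := hpos i 1; have := hpos i 2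
    have := hpos i 3; have := hpos i 4; have := hpos i 5
    fin_cases j <;> simp <;> omega
  choose J hJ using hlarge
  have hdec : ∀ i j, ∃ a d, A i j = p ^ a * d ∧ d ∈ m.divisors := by
    intro i j
    have h1 : A i j ∣ p ^ s * m := by
      rw [← hP, ← hrowP i]
      exact Finset.dvd_prod_of_mem _ (Finset.mem_univ j)
    obtain ⟨x, y, hx, hy, hxy⟩ := exists_dvd_and_dvd_of_dvd_mul h1
    obtain ⟨a, -, rfl⟩ := (Nat.dvd_prime_pow hp).1 hx
    exact ⟨a, y, hxy, Nat.mem_divisors.2 ⟨hy, hm0.ne'⟩⟩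
  choose a d had hd using hdec
  have hdpos : ∀ i j, 0 < d i j := fun i j => Nat.pos_of_mem_divisors (hd i j)
  have hkey : ∀ i i', d i (J i) = d i' (J i') → a i (J i) < a i' (J i') → False := by
    intro i i' h1 h2
    have h3 := hJ i
    have h4 := hlt i' (J i')
    rw [had] at h3 h4
    have h5 : p ^ (a i (J i) + 1) ≤ p ^ a i' (J i') := Nat.pow_le_pow_right hp.pos h2
    have h6 := Nat.mul_le_mul_right (d i' (J i')) h5
    rw [pow_succ, ← h1] at h6
    rw [← h1] at h4
    have h7 : 0 < p ^ a i (J i) * d i (J i) := Nat.mul_pos (pow_pos hp.pos _) (hdpos _ _)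
    nlinarith
  have hdinj : Function.Injective (fun i => d i (J i)) := by
    intro i i' h
    simp only at h
    rcases lt_trichotomy (a i (J i)) (a i' (J i')) with h1 | h1 | h1
    · exact (hkey _ _ h h1).elim
    · have : A i (J i) = A i' (J i') := by rw [had, had i', h, h1]
      have := @hinj (i, J i) (i', J i') this
      exact congrArg Prod.fst this
    · exact (hkey _ _ h.symm h1).elim
  have himg : Finset.univ.image (fun i => d i (J i)) = m.divisors := by
    apply Finset.eq_of_subset_of_card_le
    · intro x hx
      obtain ⟨i, -, rfl⟩ := Finset.mem_image.1 hx
      exact hd _ _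
    · rw [Finset.card_image_of_injective _ hdinj]
      simpa using hcard
  have hmm : m ∈ Finset.univ.image (fun i => d i (J i)) := by
    rw [himg]; exact Nat.mem_divisors_self m hm0.ne'
  obtain ⟨i, -, hi⟩ := Finset.mem_image.1 hmm
  generalize J i = j at hi
  have hij := had i j
  rw [hi] at hij
  have hpow : ∀ f : Fin 6 → ℕ, ∀ k, f k = p ^ a i j * m → ∏ x, f x = P →
      ∀ x, x ≠ k → ∃ e, f x = p ^ e := by
    intro f k hk hf x hx
    rw [← Finset.mul_prod_erase _ _ (Finset.mem_univ k), hk, hP, mul_right_comm] at hf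
    have h1 := Nat.eq_of_mul_eq_mul_right hm0 hf
    have h2 : f x ∣ p ^ s := by
      rw [← h1]
      exact Dvd.dvd.mul_left
        (Finset.dvd_prod_of_mem _ (Finset.mem_erase.2 ⟨hx, Finset.mem_univ _⟩)) _
    obtain ⟨e, -, he⟩ := (Nat.dvd_prime_pow hp).1 h2
    exact ⟨e, he⟩
  have hset : ∀ f : Fin 6 → ℕ, ∀ k, Function.Injective f → (∀ x, x ≠ k → ∃ e, f x = p ^ e) →
      ∑ e ∈ (Finset.univ.erase k).image (fun x => (f x).factorization p), p ^ e
        = ∑ x ∈ Finset.univ.erase k, f x := by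
    intro f k hf h
    have h1 : ∀ x, x ≠ k → p ^ (f x).factorization p = f x := by
      intro x hx
      obtain ⟨e, he⟩ := h x hx
      rw [he, hp.factorization_pow]; simp
    rw [Finset.sum_image]
    · exact Finset.sum_congr rfl fun x hx => h1 x (Finset.ne_of_mem_erase hx)
    · intro x hx y hy hxy
      simp only [Finset.coe_erase, Finset.coe_univ, Set.mem_sdiff, Set.mem_univ, true_and,
        Set.mem_singleton_iff] at hx hy
      simp only at hxy
      apply hf
      rw [← h1 x hx, ← h1 y hy, hxy]
  have hr := hpow (fun x => A i x) j hij (hrowP i)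
  have hc := hpow (fun x => A x j) i hij (hcolP j)
  have hr2 := hset (fun x => A i x) j
    (fun x y h => congrArg Prod.snd (@hinj (i, x) (i, y) h)) hr
  have hc2 := hset (fun x => A x j) i
    (fun x y h => congrArg Prod.fst (@hinj (x, j) (y, j) h)) hc
  have hs : ∑ x ∈ Finset.univ.erase j, A i x = ∑ x ∈ Finset.univ.erase i, A x j := by
    have h1 := hrow i
    have h2 := hcol j
    rw [← Finset.add_sum_erase _ _ (Finset.mem_univ j)] at h1
    rw [← Finset.add_sum_erase _ _ (Finset.mem_univ i)] at h2
    omega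
  have heq := Finset.geomSum_injective hp.two_le (hr2.trans (hs.trans hc2.symm))
  obtain ⟨k, hk⟩ := exists_ne j
  have hmem : (A i k).factorization p ∈
      (Finset.univ.erase j).image (fun x => (A i x).factorization p) :=
    Finset.mem_image.2 ⟨k, Finset.mem_erase.2 ⟨hk, Finset.mem_univ _⟩, rfl⟩
  rw [heq] at hmem
  obtain ⟨l, hl, hlk⟩ := Finset.mem_image.1 hmem
  have hl' := Finset.ne_of_mem_erase hl
  obtain ⟨e, he⟩ := hr k hk
  obtain ⟨e', he'⟩ := hc l hl'
  rw [he, he', hp.factorization_pow, hp.factorization_pow] at hlk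
  simp only [Finsupp.single_eq_same] at hlk
  have h9 : A i k = A l j := by rw [he, he', hlk]
  exact hl' (congrArg Prod.fst (@hinj (i, k) (l, j) h9)).symm

/-- If a 6×6 additive-multiplicative magic square of distinct positive integers
has magic product `P = p^s * q^5` (with `p ≠ q` primes, `s ≥ 1`) or
`P = p^s * q^2 * r` (with `p, q, r` pairwise distinct primes, `s ≥ 1`), then
`p = 2`, `p = 3`, or `p = 5`. -/
theorem six_square_product_forces_two_three_or_five
    (A : Fin 6 → Fin 6 → ℕ) (S P : ℕ)
    (hA : IsAddMulMagicSquare 6 A S P)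
    (p : ℕ) (hp : p.Prime)
    (hP : (∃ q s : ℕ, q.Prime ∧ p ≠ q ∧ 1 ≤ s ∧ P = p ^ s * q ^ 5) ∨
          (∃ q r s : ℕ, q.Prime ∧ r.Prime ∧ p ≠ q ∧ p ≠ r ∧ q ≠ r ∧ 1 ≤ s ∧
            P = p ^ s * q ^ 2 * r)) :
    p = 2 ∨ p = 3 ∨ p = 5 := by
  by_contra! hne
  obtain ⟨h2, h3, h5⟩ := hne
  have hp7 : 7 ≤ p := by
    by_contra! h
    have := hp.two_le
    interval_cases p <;> first | omega | (revert hp; norm_num)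
  rcases hP with ⟨q, s, hq, hpq, -, hP⟩ | ⟨q, r, s, hq, hr, hpq, hpr, hqr, -, hP⟩
  · refine magic_key A S P hA p hp hp7 (q ^ 5) s ?_ ?_ hP
    · intro h
      exact hpq ((Nat.prime_dvd_prime_iff_eq hp hq).1 (hp.dvd_of_dvd_pow h))
    · rw [Nat.divisors_prime_pow hq]; simp
  · refine magic_key A S P hA p hp hp7 (q ^ 2 * r) s ?_ ?_ (by rw [hP, mul_assoc])
    · intro h
      rcases hp.dvd_mul.1 h with h | h
      · exact hpq ((Nat.prime_dvd_prime_iff_eq hp hq).1 (hp.dvd_of_dvd_pow h))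
      · exact hpr ((Nat.prime_dvd_prime_iff_eq hp hr).1 h)
    · have hco : Nat.Coprime (q ^ 2) r := Nat.Coprime.pow_left 2 ((Nat.coprime_primes hq hr).2 hqr)
      rw [hco.card_divisors_mul, Nat.divisors_prime_pow hq, hr.divisors]
      simp [Finset.card_pair hr.one_lt.ne]
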